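/- arXiv:2506.05252 — 11 statements merged into one kernel-verified Lean document; each statement's English description precedes it below -/
import Mathlib

section
/- Let μ be a probability measure on ℝ^d and let r > 0, ε ∈ [0,1], β ∈ (0,1], γ ∈ (0,1), and N a positive integer. Suppose there exist centers c_1,…,c_N ∈ ℝ^d such that μ(B̄(c_k, r/2)) ≥ β for every k and μ(⋃_{k=1}^N B̄(c_k, r/2)) ≥ 1 − ε, where B̄(c,ρ) denotes the closed Euclidean ball of radius ρ around c. Then for every natural number m with m ≥ (1/β)·ln(N/γ), the set of tuples (x_1,…,x_m) satisfying μ(⋃_{i=1}^m B̄(x_i, r)) ≥ 1 − ε has μ^{⊗m}-probability at least 1 − γ (i.e., with probability at least 1 − γ over m i.i.d. draws from μ, the union of radius-r balls around the samples has μ-mass at least 1 − ε). -/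
open MeasureTheory Metric

/-- The probability that none of `m` i.i.d. samples hits a set of mass at least `β`. -/
theorem measure_pi_forall_notMem_le {α : Type*} [MeasurableSpace α] (μ : Measure α)
    [IsProbabilityMeasure μ] {β : ℝ} {s : Set α} (hs : MeasurableSet s)
    (h : ENNReal.ofReal β ≤ μ s) (m : ℕ) :
    (Measure.pi fun _ : Fin m => μ) {xs | ∀ i, xs i ∉ s} ≤
      ENNReal.ofReal (Real.exp (-(β * m))) := by
  have hset : {xs : Fin m → α | ∀ i, xs i ∉ s} = Set.univ.pi fun _ => sᶜ := by
    ext xs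
    simp
  have hcompl : μ sᶜ ≤ ENNReal.ofReal (Real.exp (-β)) := by
    rw [prob_compl_eq_one_sub hs]
    calc 1 - μ s ≤ 1 - ENNReal.ofReal β := tsub_le_tsub_left h 1
      _ ≤ ENNReal.ofReal (1 - β) := by
        rw [tsub_le_iff_right]
        calc (1 : ENNReal) = ENNReal.ofReal ((1 - β) + β) := by simp
          _ ≤ _ := ENNReal.ofReal_add_le
      _ ≤ _ := ENNReal.ofReal_le_ofReal (Real.one_sub_le_exp_neg β)
  rw [hset, Measure.pi_pi, Finset.prod_const, Finset.card_univ, Fintype.card_fin]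
  calc μ sᶜ ^ m ≤ ENNReal.ofReal (Real.exp (-β)) ^ m := by gcongr
    _ = _ := by
      rw [← ENNReal.ofReal_pow (Real.exp_pos _).le, ← Real.exp_nat_mul]
      ring_nf

/-- Covering lemma: if a probability measure `μ` on `ℝ^d` is `(ε, β, N)`-coverable by closed
balls of radius `r/2`, then for any `m ≥ (1/β)·ln(N/γ)`, with probability at least `1 - γ`
over `m` i.i.d. draws `x₁,…,x_m` from `μ`, the union of the closed balls of radius `r`
around the samples has `μ`-mass at least `1 - ε`. -/
theorem covering_lemma (d : ℕ) (μ : Measure (EuclideanSpace ℝ (Fin d)))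
    [IsProbabilityMeasure μ] (r ε β γ : ℝ) (N : ℕ)
    (hr : 0 < r) (hε : ε ∈ Set.Icc (0 : ℝ) 1) (hβ : β ∈ Set.Ioc (0 : ℝ) 1)
    (hγ : γ ∈ Set.Ioo (0 : ℝ) 1) (hN : 0 < N)
    (c : Fin N → EuclideanSpace ℝ (Fin d))
    (hmass : ∀ k, ENNReal.ofReal β ≤ μ (closedBall (c k) (r / 2)))
    (hcover : 1 - ENNReal.ofReal ε ≤ μ (⋃ k, closedBall (c k) (r / 2))) :
    ∀ m : ℕ, (1 / β) * Real.log (N / γ) ≤ m →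
      1 - ENNReal.ofReal γ ≤
        (Measure.pi fun _ : Fin m => μ)
          {xs | 1 - ENNReal.ofReal ε ≤ μ (⋃ i, closedBall (xs i) r)} := by
  intro m hm
  have hN' : (0 : ℝ) < N := by exact_mod_cast hN
  have hexp : Real.exp (-(β * m)) ≤ γ / N := by
    rw [← Real.le_log_iff_exp_le (div_pos hγ.1 hN'), ← inv_div, Real.log_inv, neg_le_neg_iff]
    rwa [one_div, inv_mul_le_iff₀ hβ.1] at hm
  have hsub : {xs : Fin m → EuclideanSpace ℝ (Fin d) |
        1 - ENNReal.ofReal ε ≤ μ (⋃ i, closedBall (xs i) r)}ᶜ ⊆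
      ⋃ k, {xs | ∀ i, xs i ∉ closedBall (c k) (r / 2)} := by
    intro xs hxs
    by_contra hmiss
    simp only [Set.mem_iUnion, Set.mem_ofPred_eq, not_exists, not_forall, not_not] at hmiss
    refine hxs (hcover.trans (measure_mono (Set.iUnion_subset fun k => ?_)))
    obtain ⟨i, hi⟩ := hmiss k
    refine Set.subset_iUnion_of_subset i fun y hy => ?_
    have := dist_triangle_right y (xs i) (c k)
    rw [mem_closedBall] at hi hy ⊢
    linarith
  have hfail : (Measure.pi fun _ : Fin m => μ)
      {xs | 1 - ENNReal.ofReal ε ≤ μ (⋃ i, closedBall (xs i) r)}ᶜ ≤ ENNReal.ofReal γ :=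
    calc _ ≤ ∑ k, (Measure.pi fun _ : Fin m => μ)
            {xs | ∀ i, xs i ∉ closedBall (c k) (r / 2)} :=
          (measure_mono hsub).trans (measure_iUnion_fintype_le _ _)
      _ ≤ ∑ _k : Fin N, ENNReal.ofReal (γ / N) := Finset.sum_le_sum fun k _ =>
          (measure_pi_forall_notMem_le μ measurableSet_closedBall (hmass k) m).trans
            (ENNReal.ofReal_le_ofReal hexp)
      _ = ENNReal.ofReal γ := by
          rw [Finset.sum_const, Finset.card_univ, Fintype.card_fin, ← ENNReal.ofReal_nsmul,
            nsmul_eq_mul, mul_div_cancel₀ _ hN'.ne']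
  rw [tsub_le_iff_right]
  calc (1 : ENNReal) = (Measure.pi fun _ : Fin m => μ) Set.univ := measure_univ.symm
    _ ≤ _ := (measure_univ_le_add_compl _).trans (by gcongr)
end

section
/- Let D be a probability measure on ℝ^d, f* : ℝ^d → Bool a ground truth with p := D({x : f*(x) = true}) > 0, and let D⁺ denote the conditional distribution of D on {x : f*(x) = true}, i.e., D⁺(A) = D(A ∩ {f* = true})/p. Fix r > 0 and let the improvement function be Δ(x) = B̄(x, r), the closed Euclidean ball of radius r around x. Suppose there exist centers c_1,…,c_N ∈ ℝ^d with D⁺(B̄(c_k, r/2)) ≥ β for every k and D⁺(⋃_{k=1}^N B̄(c_k, r/2)) ≥ 1 − ε. Let x_1,…,x_m be i.i.d. samples from D with m ≥ (1/(p·β))·ln(N/γ), and let h be the memorization predictor defined by h(x) = true iff x ∈ {x_i : f*(x_i) = true}. Then with probability at least 1 − γ over the draw of the sample, Loss_D(h, f*) ≤ ε. -/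
open MeasureTheory Metric

open Classical in
/-- Reaction set of an agent `x` to a published classifier `h`. -/
noncomputable def reactionSet {X : Type*} (Δ : X → Set X) (h : X → Bool) (x : X) : Set X :=
  if h x = true ∨ ¬ ∃ x' ∈ Δ x, h x' = true then {x}
  else {x' ∈ Δ x | h x' = true}

open Classical in
/-- Improvement loss of classifier `h` against ground truth `f` at point `x`. -/
noncomputable def improvLoss {X : Type*} (Δ : X → Set X) (h f : X → Bool) (x : X) : ℕ :=
  if ∃ x' ∈ reactionSet Δ h x, h x' ≠ f x' then 1 else 0

open Classical in
/-- Memorization predictor: label `x` positive iff `x` is a positively-labeled sample. -/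
noncomputable def memPredictor {X : Type*} {m : ℕ} (xs : Fin m → X) (fstar : X → Bool) :
    X → Bool :=
  fun x => decide (∃ i, x = xs i ∧ fstar (xs i) = true)

/-- If `A ↦ μ (A ∩ s) / μ s`, computed with outer measures on all sets `A`, is a measure,
then `s` is null-measurable. -/
theorem nullMeasurableSet_of_forall_eq_inter_div {X : Type*} [MeasurableSpace X]
    {μ ν : Measure X} {s : Set X} (hs : μ s ≠ ⊤) (h : ∀ A, ν A = μ (A ∩ s) / μ s) :
    NullMeasurableSet s μ := by
  have hcompl : ν sᶜ = 0 := by rw [h]; simp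
  have hT : ν (toMeasurable ν sᶜ) = 0 := by rw [measure_toMeasurable, hcompl]
  rw [h, ENNReal.div_eq_zero_iff, or_iff_left hs] at hT
  refine ((measurableSet_toMeasurable ν sᶜ).compl.nullMeasurableSet).congr ?_
  have hsub : (toMeasurable ν sᶜ)ᶜ ⊆ s :=
    Set.compl_subset_comm.mp (subset_toMeasurable ν sᶜ)
  refine hsub.eventuallyLE.antisymm (ae_le_set.mpr ?_)
  rwa [Set.sdiff_compl, Set.inter_comm]

/-- The memorization predictor only errs on positive points with no positive sample within
their improvement set. -/
theorem improvLoss_memPredictor_eq_one {X : Type*} {m : ℕ} {Δ : X → Set X} {xs : Fin m → X}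
    {f : X → Bool} {x : X} (h : improvLoss Δ (memPredictor xs f) f x = 1) :
    f x = true ∧ ∀ i, f (xs i) = true → xs i ∉ Δ x := by
  have hpos : ∀ y, memPredictor xs f y = true → f y = true := by
    intro y hy
    simp only [memPredictor, decide_eq_true_eq] at hy
    obtain ⟨i, rfl, hi⟩ := hy
    exact hi
  unfold improvLoss at h
  split_ifs at h with hex
  obtain ⟨y, hy, hne⟩ := hex
  unfold reactionSet at hy
  split_ifs at hy with hc
  · obtain rfl : y = x := hy
    have hfalse : memPredictor xs f y ≠ true := fun ht => hne (by rw [ht, hpos y ht])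
    refine ⟨?_, fun i hi hmem => ?_⟩
    · cases hf : f y
      · rw [hf] at hne
        exact absurd (Bool.eq_false_of_not_eq_true hfalse) hne
      · rfl
    · exact (hc.resolve_left hfalse) ⟨xs i, hmem, by
        simpa only [memPredictor, decide_eq_true_eq] using ⟨i, rfl, hi⟩⟩
  · exact absurd (by rw [hy.2, hpos y hy.2]) hne

/-- The probability that some one of `N` sets of mass at least `q` is missed by `m` independent
samples is at most `N * exp (-(q * m))`. -/
theorem measure_pi_exists_forall_notMem_le {X : Type*} [MeasurableSpace X] {μ : Measure X}
    [IsProbabilityMeasure μ] {N : ℕ} (m : ℕ) {q : ℝ} {s : Fin N → Set X}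
    (hs : ∀ k, NullMeasurableSet (s k) μ) (hq : 0 ≤ q) (hmass : ∀ k, ENNReal.ofReal q ≤ μ (s k)) :
    (Measure.pi fun _ : Fin m => μ) {xs | ∃ k, ∀ i, xs i ∉ s k} ≤
      ENNReal.ofReal (N * Real.exp (-(q * m))) := by
  have hone : ∀ k, (Measure.pi fun _ : Fin m => μ) {xs | ∀ i, xs i ∉ s k} ≤
      ENNReal.ofReal (Real.exp (-(q * m))) := by
    intro k
    have hset : {xs : Fin m → X | ∀ i, xs i ∉ s k} = Set.univ.pi fun _ => (s k)ᶜ := by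
      ext xs; simp
    have hle : μ (s k)ᶜ ≤ ENNReal.ofReal (Real.exp (-q)) := by
      rw [prob_compl_eq_one_sub₀ (hs k)]
      calc 1 - μ (s k) ≤ 1 - ENNReal.ofReal q := tsub_le_tsub_left (hmass k) 1
        _ = ENNReal.ofReal (1 - q) := by rw [ENNReal.ofReal_sub _ hq, ENNReal.ofReal_one]
        _ ≤ _ := ENNReal.ofReal_le_ofReal (Real.one_sub_le_exp_neg q)
    rw [hset, Measure.pi_pi, Finset.prod_const, Finset.card_univ, Fintype.card_fin]
    refine (pow_le_pow_left' hle m).trans_eq ?_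
    rw [← ENNReal.ofReal_pow (Real.exp_pos _).le, ← Real.exp_nat_mul]
    congr 2
    ring
  rw [Set.ofPred_exists]
  refine (measure_iUnion_fintype_le _ _).trans ((Finset.sum_le_sum fun k _ => hone k).trans_eq ?_)
  rw [Finset.sum_const, Finset.card_univ, Fintype.card_fin, nsmul_eq_mul,
    ENNReal.ofReal_mul (Nat.cast_nonneg N), ENNReal.ofReal_natCast]

/-- The memorization learning rule PAC-learns with improvements under ball improvement
sets when the positive conditional distribution is `(ε, β, N)`-coverable. -/
theorem memorization_learns (d : ℕ) (D : Measure (EuclideanSpace ℝ (Fin d)))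
    [IsProbabilityMeasure D] (fstar : EuclideanSpace ℝ (Fin d) → Bool)
    (p : ℝ) (hp : 0 < p) (hpD : D {x | fstar x = true} = ENNReal.ofReal p)
    (Dplus : Measure (EuclideanSpace ℝ (Fin d)))
    (hDplus : ∀ A : Set (EuclideanSpace ℝ (Fin d)),
      Dplus A = D (A ∩ {x | fstar x = true}) / D {x | fstar x = true})
    (r ε β γ : ℝ) (N : ℕ) (hr : 0 < r) (hε : ε ∈ Set.Icc (0 : ℝ) 1)
    (hβ : β ∈ Set.Ioc (0 : ℝ) 1) (hγ : γ ∈ Set.Ioo (0 : ℝ) 1) (hN : 0 < N)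
    (c : Fin N → EuclideanSpace ℝ (Fin d))
    (hmass : ∀ k, ENNReal.ofReal β ≤ Dplus (closedBall (c k) (r / 2)))
    (hcover : 1 - ENNReal.ofReal ε ≤ Dplus (⋃ k, closedBall (c k) (r / 2)))
    (m : ℕ) (hm : (1 / (p * β)) * Real.log (N / γ) ≤ m) :
    1 - ENNReal.ofReal γ ≤
      (Measure.pi fun _ : Fin m => D)
        {xs | D {x | improvLoss (fun x => closedBall x r)
                  (memPredictor xs fstar) fstar x = 1}
              ≤ ENNReal.ofReal ε} := by
  have hS0 : D {x | fstar x = true} ≠ 0 := by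
    rw [hpD]; exact (ENNReal.ofReal_pos.mpr hp).ne'
  have hStop : D {x | fstar x = true} ≠ ⊤ := measure_ne_top _ _
  have hSm : NullMeasurableSet {x | fstar x = true} D :=
    nullMeasurableSet_of_forall_eq_inter_div hStop hDplus
  have : IsProbabilityMeasure Dplus :=
    ⟨by rw [hDplus, Set.univ_inter, ENNReal.div_self hS0 hStop]⟩
  have hU : MeasurableSet (⋃ k, closedBall (c k) (r / 2)) :=
    MeasurableSet.iUnion fun _ => measurableSet_closedBall
  have hmiss : D ((⋃ k, closedBall (c k) (r / 2))ᶜ ∩ {x | fstar x = true}) ≤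
      ENNReal.ofReal ε := by
    have hc : Dplus (⋃ k, closedBall (c k) (r / 2))ᶜ ≤ ENNReal.ofReal ε := by
      rw [prob_compl_eq_one_sub hU]
      exact tsub_le_iff_tsub_le.mp hcover
    rw [hDplus, ENNReal.div_le_iff hS0 hStop] at hc
    exact hc.trans (mul_le_of_le_one_right' prob_le_one)
  have hbad : (Measure.pi fun _ : Fin m => D)
      {xs | ∃ k, ∀ i, xs i ∉ closedBall (c k) (r / 2) ∩ {x | fstar x = true}} ≤
      ENNReal.ofReal γ := by
    refine (measure_pi_exists_forall_notMem_le m (q := p * β)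
      (fun k => measurableSet_closedBall.nullMeasurableSet.inter hSm)
      (mul_pos hp hβ.1).le fun k => ?_).trans (ENNReal.ofReal_le_ofReal ?_)
    · have hk := hmass k
      rw [hDplus, ENNReal.le_div_iff_mul_le (.inl hS0) (.inl hStop), hpD] at hk
      rwa [ENNReal.ofReal_mul hp.le, mul_comm]
    · have hN' : (0 : ℝ) < N := Nat.cast_pos.mpr hN
      have hlog : Real.log (N / γ) ≤ p * β * m := by
        rwa [one_div, inv_mul_le_iff₀ (mul_pos hp hβ.1)] at hm
      calc (N : ℝ) * Real.exp (-(p * β * m))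
          ≤ N * Real.exp (-Real.log (N / γ)) := by gcongr
        _ = γ := by
          rw [Real.exp_neg, Real.exp_log (div_pos hN' hγ.1)]
          field_simp
  rw [tsub_le_iff_right]
  calc (1 : ENNReal) = (Measure.pi fun _ : Fin m => D) Set.univ := measure_univ.symm
    _ ≤ _ := (measure_mono fun xs _ => ?_).trans (measure_union_le _ _)
    _ ≤ _ := add_le_add_right hbad _
  by_cases hxs : ∃ k, ∀ i, xs i ∉ closedBall (c k) (r / 2) ∩ {x | fstar x = true}
  · exact .inr hxs
  refine .inl ((measure_mono fun x hx => ?_).trans hmiss)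
  push Not at hxs
  obtain ⟨hfx, hno⟩ := improvLoss_memPredictor_eq_one hx
  refine ⟨fun hxU => ?_, hfx⟩
  obtain ⟨k, hk⟩ := Set.mem_iUnion.mp hxU
  obtain ⟨i, hi, hfi⟩ := hxs k
  refine hno i hfi (mem_closedBall.mpr ?_)
  linarith [dist_triangle_right (xs i) x (c k), mem_closedBall.mp hi, mem_closedBall.mp hk]
end

section
/- Let X be any instance space, Δ : X → Set X any improvement function, and let h, f* : X → Bool satisfy: (a) {x : h(x) = true} ⊆ {x : f*(x) = true} (h has no false positives), and (b) for every x with f*(x) = true and h(x) = false there exists x' ∈ Δ(x) with h(x') = true (every false negative can improve to a point h labels positive). Then Loss(x; h, f*) = 0 for every x ∈ X. -/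
/-- If `h` has no false positives and every false negative can improve to a point `h`
labels positive, then the improvement loss is zero everywhere. -/
theorem zero_loss_of_no_false_positives_and_improvable {X : Type*} (Δ : X → Set X)
    (h fstar : X → Bool)
    (hnofp : {x | h x = true} ⊆ {x | fstar x = true})
    (himp : ∀ x, fstar x = true → h x = false → ∃ x' ∈ Δ x, h x' = true) :
    ∀ x : X, improvLoss Δ h fstar x = 0 := by
  intro x
  refine if_neg ?_
  rintro ⟨y, hy, hne⟩
  have agree_of_pos : ∀ z, h z = true → h z = fstar z := fun z hz => hz.trans (hnofp hz).symm
  unfold reactionSet at hy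
  split_ifs at hy with hx
  · obtain rfl : y = x := hy
    rcases hx with hx | hx
    · exact hne (agree_of_pos y hx)
    · cases hh : h y with
      | true => exact hne (agree_of_pos y hh)
      | false =>
        cases hf : fstar y with
        | true => exact hx (himp y hf hh)
        | false => exact hne (hh.trans hf.symm)
  · exact hne (agree_of_pos y hy.2)
end

section
/- Let X be any instance space and let h, f* : X → Bool satisfy {x : h(x) = true} ⊆ {x : f*(x) = true} (h has no false positives). Let Δ_1, Δ_2 : X → Set X be two improvement functions with Δ_1(x) ⊆ Δ_2(x) for every x ∈ X. Then for every x ∈ X, the improvement loss of h against f* under Δ_2 is at most the improvement loss under Δ_1; that is, Loss^{Δ_2}(x; h, f*) ≤ Loss^{Δ_1}(x; h, f*). In particular, for any probability measure D on X, Loss^{Δ_2}_D(h, f*) ≤ Loss^{Δ_1}_D(h, f*): enlarging the improvement sets can only decrease the loss of a classifier with no false positives. -/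
open MeasureTheory

/-- A classifier with no false positives incurs improvement loss exactly at the points it
misclassifies and from which no positively classified point is reachable. -/
theorem improvLoss_eq_one_iff {X : Type*} {h f : X → Bool}
    (hnofp : {x | h x = true} ⊆ {x | f x = true}) (Δ : X → Set X) (x : X) :
    improvLoss Δ h f x = 1 ↔ h x ≠ f x ∧ ∀ x' ∈ Δ x, h x' ≠ true := by
  have hf : ∀ y, h y = true → f y = true := fun y hy => hnofp hy
  by_cases hx : h x = true
  · simp [improvLoss, reactionSet, hx, hf x hx]
  · by_cases hex : ∃ x' ∈ Δ x, h x' = true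
    · have hno : ¬ ∃ x' ∈ reactionSet Δ h x, h x' ≠ f x' := by
        rintro ⟨y, hy, hne⟩
        rw [reactionSet, if_neg (not_or.mpr ⟨hx, not_not.mpr hex⟩)] at hy
        exact hne (hy.2.trans (hf y hy.2).symm)
      rw [improvLoss, if_neg hno]
      obtain ⟨y, hy, hyt⟩ := hex
      exact iff_of_false zero_ne_one fun hall => hall.2 y hy hyt
    · have hreact : reactionSet Δ h x = {x} := if_pos (Or.inr hex)
      have hall : ∀ x' ∈ Δ x, h x' ≠ true := fun y hy hyt => hex ⟨y, hy, hyt⟩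
      rw [improvLoss, hreact, and_iff_left hall]
      simp

/-- For a classifier with no false positives, enlarging the improvement sets can only
decrease the improvement loss, both pointwise and in distribution. -/
theorem loss_antitone_in_improvement_set {X : Type*} [MeasurableSpace X]
    (h fstar : X → Bool)
    (hnofp : {x | h x = true} ⊆ {x | fstar x = true})
    (Δ₁ Δ₂ : X → Set X) (hsub : ∀ x, Δ₁ x ⊆ Δ₂ x) :
    (∀ x : X, improvLoss Δ₂ h fstar x ≤ improvLoss Δ₁ h fstar x) ∧
      ∀ D : Measure X, IsProbabilityMeasure D →
        D {x | improvLoss Δ₂ h fstar x = 1} ≤ D {x | improvLoss Δ₁ h fstar x = 1} := by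
  have hone : ∀ x, improvLoss Δ₂ h fstar x = 1 → improvLoss Δ₁ h fstar x = 1 := fun x hx => by
    rw [improvLoss_eq_one_iff hnofp] at hx ⊢
    exact ⟨hx.1, fun x' hx' => hx.2 x' (hsub x hx')⟩
  refine ⟨fun x => ?_, fun D _ => measure_mono hone⟩
  by_cases hx : improvLoss Δ₂ h fstar x = 1
  · rw [hx, hone x hx]
  · have hzero : improvLoss Δ₂ h fstar x = 0 := by
      unfold improvLoss at hx ⊢
      exact if_neg fun hex => hx (if_pos hex)
    rw [hzero]
    exact Nat.zero_le _
end

section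
/- Fix r > 0 and let the improvement function on ℝ^d be Δ(x) = B̄(x, r), the closed Euclidean ball of radius r around x. Then for every classifier h : ℝ^d → Bool and every point z ∈ ℝ^d, at least one of the following holds: Loss(z; h, f_0) = 1, where f_0 is the constant-false labeling, or Loss(z; h, f_z) = 1, where f_z is the labeling with f_z(z) = true and f_z(x) = false for all x ≠ z. -/
open Metric

open Classical in
/-- Under ball improvement sets, for any classifier `h` and any point `z`, `h` errs at
`z` either against the all-negative ground truth or against the ground truth that is
positive exactly at `z`. -/
theorem loss_dichotomy (d : ℕ) (r : ℝ) (hr : 0 < r)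
    (h : EuclideanSpace ℝ (Fin d) → Bool) (z : EuclideanSpace ℝ (Fin d)) :
    improvLoss (fun x => closedBall x r) h (fun _ => false) z = 1 ∨
      improvLoss (fun x => closedBall x r) h (fun x => decide (x = z)) z = 1 := by
  by_cases hz : h z = true
  · left
    exact if_pos ⟨z, by simp [reactionSet, hz], by simp [hz]⟩
  · by_cases hex : ∃ x' ∈ closedBall z r, h x' = true
    · left
      obtain ⟨x', hx', hh⟩ := hex
      have hmem : x' ∈ reactionSet (fun x => closedBall x r) h z := by
        rw [reactionSet, if_neg (not_or.mpr ⟨hz, not_not.mpr ⟨x', hx', hh⟩⟩)]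
        exact ⟨hx', hh⟩
      exact if_pos ⟨x', hmem, by simp [hh]⟩
    · right
      have hmem : z ∈ reactionSet (fun x => closedBall x r) h z := by
        rw [reactionSet, if_pos (Or.inr hex)]
        rfl
      exact if_pos ⟨z, hmem, by simpa using hz⟩
end

section
/- Fix r > 0 and let the improvement function on ℝ^d be Δ(x) = B̄(x, r), the closed Euclidean ball of radius r around x. Let x_1,…,x_N ∈ ℝ^d be distinct points with ‖x_j − x_k‖ > r for all j ≠ k, and let D be the uniform distribution on {x_1,…,x_N} (each point has mass β = 1/N). Then for every classifier h : ℝ^d → Bool, every index j ∈ {1,…,N}, and every assignment g : {x_1,…,x_N} \ {x_j} → Bool, there exists a ground truth f* : ℝ^d → Bool with {x : f*(x) = true} ⊆ {x_1,…,x_N} and f*(x_k) = g(x_k) for all k ≠ j, such that Loss(x_j; h, f*) = 1, and consequently Loss_D(h, f*) ≥ β. (Hence no learner that might fail to observe some point x_j can guarantee improvement loss below β = 1/N.) -/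
open Metric MeasureTheory ENNReal

/-- Lower bound construction: for well-separated support points and the uniform
distribution on them, any classifier can be made to err on any chosen unsampled point
by some ground truth consistent with the labels of all remaining points, forcing
improvement loss at least `β = 1/N`. -/
theorem ball_lower_bound (d : ℕ) (r : ℝ) (hr : 0 < r) (N : ℕ) (hN : 0 < N)
    (xs : Fin N → EuclideanSpace ℝ (Fin d)) (hinj : Function.Injective xs)
    (hsep : ∀ j k, j ≠ k → r < dist (xs j) (xs k))
    (D : Measure (EuclideanSpace ℝ (Fin d)))
    (hD : D = (N : ℝ≥0∞)⁻¹ • ∑ j : Fin N, Measure.dirac (xs j))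
    (h : EuclideanSpace ℝ (Fin d) → Bool) (j : Fin N) (g : Fin N → Bool) :
    ∃ fstar : EuclideanSpace ℝ (Fin d) → Bool,
      {x | fstar x = true} ⊆ Set.range xs ∧
      (∀ k, k ≠ j → fstar (xs k) = g k) ∧
      improvLoss (fun x => closedBall x r) h fstar (xs j) = 1 ∧
      (N : ℝ≥0∞)⁻¹ ≤ D {x | improvLoss (fun x => closedBall x r) h fstar x = 1} := by
  classical
  let lab : Fin N → Bool := fun k => if k = j then !h (xs j) else g k
  let f : EuclideanSpace ℝ (Fin d) → Bool := fun x => decide (∃ k, xs k = x ∧ lab k = true)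
  have f_apply : ∀ k, f (xs k) = lab k := by
    intro k
    simp [f, hinj.eq_iff]
  have loss_eq : improvLoss (fun x => closedBall x r) h f (xs j) = 1 := by
    unfold improvLoss
    rw [if_pos]
    have h_ne : h (xs j) ≠ f (xs j) := by simp [f_apply, lab]
    unfold reactionSet
    split_ifs with hc
    · exact ⟨xs j, rfl, h_ne⟩
    · push Not at hc
      obtain ⟨hj, y, hy, hhy⟩ := hc
      refine ⟨y, ⟨hy, hhy⟩, ?_⟩
      have f_false : f y = false := by
        refine decide_eq_false ?_
        rintro ⟨k, rfl, -⟩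
        by_cases hk : k = j
        · subst hk
          exact hj hhy
        · exact absurd (mem_closedBall.mp hy) (not_le.mpr (hsep k j hk))
      simp [hhy, f_false]
  refine ⟨f, ?_, fun k hk => by simp [f_apply, lab, hk], loss_eq, ?_⟩
  · intro x hx
    obtain ⟨k, hk, -⟩ := of_decide_eq_true hx
    exact ⟨k, hk⟩
  · set S := {x | improvLoss (fun x => closedBall x r) h f x = 1}
    have dirac_eq : Measure.dirac (xs j) S = 1 := Measure.dirac_apply_of_mem loss_eq
    have one_le : 1 ≤ ∑ i : Fin N, Measure.dirac (xs i) S := by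
      rw [← dirac_eq]
      exact Finset.single_le_sum (f := fun i => Measure.dirac (xs i) S)
        (fun _ _ => zero_le) (Finset.mem_univ j)
    rw [hD, Measure.smul_apply, Measure.finsetSum_apply, smul_eq_mul]
    exact le_mul_of_one_le_right' one_le
end

section
/- Let G = (V, E) be a finite undirected graph with maximum degree at most Δ_G, where Δ_G ≥ 1, and let the improvement function be Δ(x) = {x' ∈ V : (x, x') ∈ E}. Let H be a finite nonempty set of functions V → Bool containing the ground truth f*, and define the risk-averse majority predictor ĥ(v) = true iff |{h ∈ H : h(v) = true}| ≥ (Δ_G/(Δ_G + 1))·|H|. Suppose a query node x ∈ V yields a mistake, i.e., Loss(x; ĥ, f*) = 1, and define Δ⁺ = {x' ∈ Δ(x) : ĥ(x') = true} and H' = {h ∈ H : h(x') = true for all x' ∈ Δ⁺}. Define the updated set H_new as follows: if ĥ(x) = false and Δ⁺ = ∅ then H_new = {h ∈ H : h(x) = true}; if ĥ(x) = false and Δ⁺ ≠ ∅ then H_new = H \ H'; if ĥ(x) = true then H_new = {h ∈ H : h(x) = false}. Then f* ∈ H_new and |H_new| ≤ (1 − 1/(Δ_G + 1))·|H|. -/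
open Classical in
/-- Risk-averse majority vote predictor: predict positive iff at least a
`Δ_G/(Δ_G+1)` fraction of the surviving hypotheses predict positive. -/
noncomputable def raPredictor {V : Type*} (ΔG : ℕ) (H : Finset (V → Bool)) : V → Bool :=
  fun v => decide
    ((ΔG : ℝ) / (ΔG + 1) * H.card ≤ ((H.filter fun h => h v = true).card : ℝ))

open Classical in
/-- Risk-averse majority vote update of the version space after a mistake on node `x`. -/
noncomputable def raUpdate {V : Type*} [Fintype V] [DecidableEq V] (G : SimpleGraph V)
    [DecidableRel G.Adj] (ΔG : ℕ) (H : Finset (V → Bool)) (x : V) :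
    Finset (V → Bool) :=
  let hhat := raPredictor ΔG H
  let Δplus := (G.neighborFinset x).filter fun x' => hhat x' = true
  let H' := H.filter fun h => ∀ x' ∈ Δplus, h x' = true
  if hhat x = true then H.filter fun h => h x = false
  else if Δplus = ∅ then H.filter fun h => h x = true
  else H \ H'

theorem raPredictor_eq_true_iff {V : Type*} (ΔG : ℕ) (H : Finset (V → Bool)) (v : V) :
    raPredictor ΔG H v = true ↔
      (ΔG : ℝ) * H.card ≤ (ΔG + 1) * ((H.filter fun h => h v = true).card : ℝ) := by
  have hpos : (0 : ℝ) < ΔG + 1 := by positivity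
  simp only [raPredictor, decide_eq_true_eq]
  rw [div_mul_eq_mul_div, div_le_iff₀ hpos, mul_comm (_ : ℝ) ((ΔG : ℝ) + 1)]

/-- At most a `1/(Δ_G+1)` fraction of the hypotheses dissents from a positive prediction. -/
theorem card_filter_eq_false_le_of_raPredictor {V : Type*} (ΔG : ℕ) (H : Finset (V → Bool))
    (v : V) (hv : raPredictor ΔG H v = true) :
    (ΔG + 1) * ((H.filter fun h => h v = false).card : ℝ) ≤ H.card := by
  rw [raPredictor_eq_true_iff] at hv
  have hsplit : ((H.filter fun h => h v = true).card : ℝ)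
      + ((H.filter fun h => h v = false).card : ℝ) = H.card := by
    have := H.card_filter_add_card_filter_not (fun h => h v = true)
    simp only [Bool.not_eq_true] at this
    exact_mod_cast this
  nlinarith

/-- The hypotheses rejecting some node of a set of at most `Δ_G` positively predicted nodes
make up at most a `Δ_G/(Δ_G+1)` fraction of all hypotheses. -/
theorem card_filter_exists_eq_false_le {V : Type*} (ΔG : ℕ) (H : Finset (V → Bool))
    (S : Finset V) (hS : ∀ v ∈ S, raPredictor ΔG H v = true) (hcard : S.card ≤ ΔG) :
    (ΔG + 1) * ((H.filter fun h => ∃ v ∈ S, h v = false).card : ℝ) ≤ ΔG * H.card := by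
  classical
  have hpos : (0 : ℝ) < ΔG + 1 := by positivity
  have hsub : (H.filter fun h => ∃ v ∈ S, h v = false) ⊆
      S.biUnion fun v => H.filter fun h => h v = false := by
    intro h hh
    simp only [Finset.mem_filter, Finset.mem_biUnion] at hh ⊢
    obtain ⟨hH, v, hv, hf⟩ := hh
    exact ⟨v, hv, hH, hf⟩
  have hle : ((H.filter fun h => ∃ v ∈ S, h v = false).card : ℝ) ≤
      ∑ v ∈ S, ((H.filter fun h => h v = false).card : ℝ) := by
    exact_mod_cast (Finset.card_le_card hsub).trans Finset.card_biUnion_le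
  calc (ΔG + 1) * ((H.filter fun h => ∃ v ∈ S, h v = false).card : ℝ)
      ≤ (ΔG + 1) * ∑ v ∈ S, ((H.filter fun h => h v = false).card : ℝ) := by gcongr
    _ = ∑ v ∈ S, (ΔG + 1) * ((H.filter fun h => h v = false).card : ℝ) := Finset.mul_sum ..
    _ ≤ ∑ _v ∈ S, (H.card : ℝ) := Finset.sum_le_sum fun v hv =>
        card_filter_eq_false_le_of_raPredictor ΔG H v (hS v hv)
    _ = S.card * H.card := by simp
    _ ≤ ΔG * H.card := by gcongr

/-- One step of the risk-averse majority vote algorithm: after any mistake, the ground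
truth survives and at least a `1/(Δ_G+1)` fraction of hypotheses is discarded. -/
theorem ra_majority_step {V : Type*} [Fintype V] [DecidableEq V] (G : SimpleGraph V)
    [DecidableRel G.Adj] (ΔG : ℕ) (hΔ : 1 ≤ ΔG) (hdeg : ∀ v, G.degree v ≤ ΔG)
    (H : Finset (V → Bool)) (hne : H.Nonempty)
    (fstar : V → Bool) (hf : fstar ∈ H) (x : V)
    (hmistake : improvLoss (fun v => (G.neighborSet v : Set V))
      (raPredictor ΔG H) fstar x = 1) :
    fstar ∈ raUpdate G ΔG H x ∧
      ((raUpdate G ΔG H x).card : ℝ) ≤ (1 - 1 / (ΔG + 1)) * H.card := by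
  have hpos : (0 : ℝ) < ΔG + 1 := by positivity
  have hΔ' : (1 : ℝ) ≤ ΔG := by exact_mod_cast hΔ
  have hbound : ∀ c : ℝ, (ΔG + 1) * c ≤ ΔG * H.card → c ≤ (1 - 1 / (ΔG + 1)) * H.card := by
    intro c hc
    have : (1 - 1 / ((ΔG : ℝ) + 1)) * H.card = ΔG * H.card / (ΔG + 1) := by
      field_simp
      ring
    rw [this, le_div_iff₀ hpos]
    linarith
  obtain ⟨y, hy, hyf⟩ : ∃ y ∈ reactionSet (fun v => (G.neighborSet v : Set V))
      (raPredictor ΔG H) x, raPredictor ΔG H y ≠ fstar y := by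
    by_contra hcon
    simp [improvLoss, hcon] at hmistake
  by_cases hx : raPredictor ΔG H x = true
  · have hyx : y = x := by simpa [reactionSet, hx] using hy
    subst hyx
    simp only [raUpdate, hx, if_true]
    refine ⟨?_, hbound _ ?_⟩
    · rw [hx] at hyf
      simpa [hf] using hyf
    · have := card_filter_eq_false_le_of_raPredictor ΔG H y hx
      nlinarith [Nat.cast_nonneg (α := ℝ) H.card]
  · simp only [raUpdate, if_neg hx]
    split_ifs with hempty
    · have hnone : ¬ ∃ z ∈ G.neighborSet x, raPredictor ΔG H z = true := by
        rintro ⟨z, hz, hzt⟩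
        have : z ∈ (∅ : Finset V) := by
          rw [← hempty]
          simpa [hzt] using hz
        simp at this
      rw [reactionSet, if_pos (Or.inr hnone), Set.mem_singleton_iff] at hy
      subst hy
      refine ⟨?_, hbound _ ?_⟩
      · rw [Bool.not_eq_true] at hx
        rw [hx] at hyf
        simpa [hf] using hyf
      · rw [raPredictor_eq_true_iff, not_le] at hx
        exact hx.le
    · set S := (G.neighborFinset x).filter fun z => raPredictor ΔG H z = true with hS
      have hsome : ∃ z ∈ G.neighborSet x, raPredictor ΔG H z = true := by
        obtain ⟨z, hz⟩ := Finset.nonempty_iff_ne_empty.mpr hempty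
        exact ⟨z, by simpa [hS] using hz⟩
      rw [reactionSet, if_neg (not_or.mpr ⟨hx, not_not_intro hsome⟩)] at hy
      obtain ⟨hadj, hyt⟩ := hy
      have hyS : y ∈ S := by simpa [hS, hyt] using hadj
      refine ⟨?_, hbound _ ?_⟩
      · simp only [Finset.mem_sdiff, Finset.mem_filter, not_and]
        exact ⟨hf, fun _ hall => hyf (hyt.trans (hall y hyS).symm)⟩
      · have hcard : S.card ≤ ΔG :=
          (Finset.card_filter_le _ _).trans ((G.card_neighborFinset_eq_degree x).trans_le (hdeg x))
        convert card_filter_exists_eq_false_le ΔG H S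
          (fun v hv => (Finset.mem_filter.mp hv).2) hcard using 4
        ext h
        simp only [Finset.mem_sdiff, Finset.mem_filter, not_and, not_forall, Bool.not_eq_true,
          exists_prop]
        tauto
end

section
/- Let G = (V, E) be a finite undirected graph with maximum degree at most Δ_G, where Δ_G ≥ 1, let the improvement function be Δ(x) = {x' ∈ V : (x, x') ∈ E}, let H_0 be a finite nonempty set of functions V → Bool, and let f* ∈ H_0. Consider the online process: H_1 = H_0; at each round t, the predictor is ĥ_t(v) = true iff |{h ∈ H_t : h(v) = true}| ≥ (Δ_G/(Δ_G + 1))·|H_t|; an arbitrary (adversarially chosen) node x_t ∈ V is queried; a mistake occurs at round t iff Loss(x_t; ĥ_t, f*) = 1; if a mistake occurs, H_{t+1} is obtained from H_t by the risk-averse majority vote update (with Δ⁺_t = {x' ∈ Δ(x_t) : ĥ_t(x') = true} and H'_t = {h ∈ H_t : h(x') = true for all x' ∈ Δ⁺_t}: if ĥ_t(x_t) = false and Δ⁺_t = ∅ then H_{t+1} = {h ∈ H_t : h(x_t) = true}; if ĥ_t(x_t) = false and Δ⁺_t ≠ ∅ then H_{t+1} = H_t \ H'_t; if ĥ_t(x_t)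 = true then H_{t+1} = {h ∈ H_t : h(x_t) = false}); otherwise H_{t+1} = H_t. Then for every T and every sequence of queried nodes, the total number of mistakes in rounds 1,…,T is at most (Δ_G + 1)·ln|H_0|. -/
theorem card_filter_false_le_of_raPredictor {V : Type*} (ΔG : ℕ) (H : Finset (V → Bool)) (v : V)
    (hv : raPredictor ΔG H v = true) :
    ((H.filter fun h => h v = false).card : ℝ) ≤ H.card / (ΔG + 1) := by
  classical
  have hv' : (ΔG : ℝ) / (ΔG + 1) * H.card ≤ ((H.filter fun h => h v = true).card : ℝ) := by
    simpa [raPredictor] using hv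
  have hsplit := H.card_filter_add_card_filter_not (fun h => h v = true)
  simp only [Bool.not_eq_true] at hsplit
  have hsplit' : ((H.filter fun h => h v = true).card : ℝ)
      + ((H.filter fun h => h v = false).card : ℝ) = H.card := by exact_mod_cast hsplit
  have hsum : (ΔG : ℝ) / (ΔG + 1) * H.card + H.card / (ΔG + 1) = H.card := by
    field_simp
  linarith

theorem card_filter_true_le_of_raPredictor {V : Type*} (ΔG : ℕ) (H : Finset (V → Bool)) (v : V)
    (hv : raPredictor ΔG H v = false) :
    ((H.filter fun h => h v = true).card : ℝ) ≤ ΔG / (ΔG + 1) * H.card := by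
  have hv' : ((H.filter fun h => h v = true).card : ℝ) < (ΔG : ℝ) / (ΔG + 1) * H.card := by
    simpa [raPredictor] using hv
  exact hv'.le

/-- After a mistake, the risk-averse update keeps the target. -/
theorem mem_raUpdate_of_improvLoss {V : Type*} [Fintype V] [DecidableEq V]
    (G : SimpleGraph V) [DecidableRel G.Adj] (ΔG : ℕ) (H : Finset (V → Bool))
    (f : V → Bool) (hf : f ∈ H) (x : V)
    (hloss : improvLoss (fun v => (G.neighborSet v : Set V)) (raPredictor ΔG H) f x = 1) :
    f ∈ raUpdate G ΔG H x := by
  classical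
  have hmis : ∃ x' ∈ reactionSet (fun v => (G.neighborSet v : Set V)) (raPredictor ΔG H) x,
      raPredictor ΔG H x' ≠ f x' := by
    by_contra hcon
    rw [improvLoss, if_neg hcon] at hloss
    exact zero_ne_one hloss
  obtain ⟨x', hx', hne⟩ := hmis
  simp only [reactionSet, SimpleGraph.mem_neighborSet] at hx'
  simp only [raUpdate]
  by_cases hx : raPredictor ΔG H x = true
  · rw [if_pos (Or.inl hx), Set.mem_singleton_iff] at hx'
    subst hx'
    rw [if_pos hx, Finset.mem_filter]
    exact ⟨hf, by simpa [hx] using hne⟩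
  · rw [if_neg hx]
    by_cases hnbr : ∃ y, G.Adj x y ∧ raPredictor ΔG H y = true
    · rw [if_neg (not_or.2 ⟨hx, not_not.2 hnbr⟩)] at hx'
      obtain ⟨hadj, hpos⟩ := hx'
      have hadj' : G.Adj x x' := hadj
      have hx'mem : x' ∈ (G.neighborFinset x).filter fun y => raPredictor ΔG H y = true := by
        simp [hadj', hpos]
      rw [if_neg (Finset.ne_empty_of_mem hx'mem), Finset.mem_sdiff, Finset.mem_filter]
      refine ⟨hf, fun hall => hne ?_⟩
      rw [hpos, hall.2 x' hx'mem]
    · rw [if_pos (Or.inr hnbr), Set.mem_singleton_iff] at hx'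
      subst hx'
      have hempty : ((G.neighborFinset x').filter fun y => raPredictor ΔG H y = true) = ∅ := by
        refine Finset.filter_eq_empty_iff.2 fun y hy hpos => hnbr ⟨y, ?_, hpos⟩
        simpa using hy
      rw [if_pos hempty, Finset.mem_filter]
      exact ⟨hf, by simpa [hx] using hne⟩

/-- The risk-averse update shrinks the version space by a factor `Δ_G / (Δ_G + 1)`. -/
theorem card_raUpdate_le {V : Type*} [Fintype V] [DecidableEq V]
    (G : SimpleGraph V) [DecidableRel G.Adj] (ΔG : ℕ) (hΔ : 1 ≤ ΔG) (H : Finset (V → Bool))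
    (x : V) (hdeg : G.degree x ≤ ΔG) :
    ((raUpdate G ΔG H x).card : ℝ) ≤ ΔG / (ΔG + 1) * H.card := by
  classical
  have hΔ' : (1 : ℝ) ≤ ΔG := by exact_mod_cast hΔ
  have hscale : ∀ k : ℝ, k ≤ ΔG → k * (H.card / (ΔG + 1)) ≤ ΔG / (ΔG + 1) * H.card := by
    intro k hk
    calc k * ((H.card : ℝ) / (ΔG + 1)) ≤ ΔG * (H.card / (ΔG + 1)) := by gcongr
      _ = ΔG / (ΔG + 1) * H.card := by ring
  simp only [raUpdate]
  split_ifs with hx hempty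
  · have := card_filter_false_le_of_raPredictor ΔG H x hx
    linarith [hscale 1 hΔ']
  · exact card_filter_true_le_of_raPredictor ΔG H x (by simpa using hx)
  · set D := (G.neighborFinset x).filter fun y => raPredictor ΔG H y = true with hD
    have hDcard : (D.card : ℝ) ≤ ΔG := by
      exact_mod_cast (Finset.card_filter_le _ _).trans
        ((G.card_neighborFinset_eq_degree x).le.trans hdeg)
    refine le_trans ?_ (hscale D.card hDcard)
    have hsub : (H \ H.filter fun h => ∀ y ∈ D, h y = true) ⊆
        D.biUnion fun y => H.filter fun h => h y = false := by
      intro h hh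
      simp only [Finset.mem_sdiff, Finset.mem_filter, not_and, not_forall,
        Bool.not_eq_true] at hh
      obtain ⟨hH, hfail⟩ := hh
      obtain ⟨y, hy, hfalse⟩ := hfail hH
      exact Finset.mem_biUnion.2 ⟨y, hy, Finset.mem_filter.2 ⟨hH, hfalse⟩⟩
    have hcard : ((D.biUnion fun y => H.filter fun h => h y = false).card : ℝ) ≤
        ∑ y ∈ D, ((H.filter fun h => h y = false).card : ℝ) := by
      exact_mod_cast Finset.card_biUnion_le
    have hsum : ∑ y ∈ D, ((H.filter fun h => h y = false).card : ℝ) ≤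
        D.card * (H.card / (ΔG + 1)) := by
      rw [← nsmul_eq_mul]
      exact Finset.sum_le_card_nsmul _ _ _ fun y hy =>
        card_filter_false_le_of_raPredictor ΔG H y (Finset.mem_filter.1 hy).2
    refine le_trans ?_ (hcard.trans hsum)
    exact_mod_cast (Finset.card_le_card (by convert hsub))

theorem one_add_mul_log_le_mul_log {n : ℕ} (hn : 1 ≤ n) {a b : ℝ} (ha : 0 < a) (hb : 0 < b)
    (hab : a ≤ n / (n + 1) * b) :
    1 + ((n : ℝ) + 1) * Real.log a ≤ (n + 1) * Real.log b := by
  have hn' : (0 : ℝ) < n := by exact_mod_cast hn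
  have hq : (0 : ℝ) < n / (n + 1) := by positivity
  have hlog : Real.log a ≤ Real.log (n / (n + 1)) + Real.log b := by
    rw [← Real.log_mul hq.ne' hb.ne']
    exact Real.log_le_log ha hab
  have hlogq := Real.log_le_sub_one_of_pos hq
  have hmul : ((n : ℝ) + 1) * Real.log a ≤ (n + 1) * (n / (n + 1) - 1 + Real.log b) := by
    gcongr
    linarith
  have hexp : ((n : ℝ) + 1) * (n / (n + 1) - 1 + Real.log b) = -1 + (n + 1) * Real.log b := by
    field_simp
    ring
  linarith

open Classical in
/-- Mistake bound for the risk-averse majority vote algorithm in realizable online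
learning with improvements on a graph: at most `(Δ_G + 1)·ln|H₀|` mistakes. -/
theorem ra_majority_mistake_bound {V : Type*} [Fintype V] [DecidableEq V]
    (G : SimpleGraph V) [DecidableRel G.Adj]
    (ΔG : ℕ) (hΔ : 1 ≤ ΔG) (hdeg : ∀ v, G.degree v ≤ ΔG)
    (H0 : Finset (V → Bool)) (hne : H0.Nonempty)
    (fstar : V → Bool) (hf : fstar ∈ H0)
    (x : ℕ → V) (H : ℕ → Finset (V → Bool)) (hinit : H 0 = H0)
    (hstep : ∀ t, H (t + 1) =
      if improvLoss (fun v => (G.neighborSet v : Set V))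
          (raPredictor ΔG (H t)) fstar (x t) = 1
      then raUpdate G ΔG (H t) (x t) else H t)
    (T : ℕ) :
    (((Finset.range T).filter fun t =>
        improvLoss (fun v => (G.neighborSet v : Set V))
          (raPredictor ΔG (H t)) fstar (x t) = 1).card : ℝ)
      ≤ (ΔG + 1) * Real.log H0.card := by
  have hinv : fstar ∈ H T ∧
      (((Finset.range T).filter fun t =>
        improvLoss (fun v => (G.neighborSet v : Set V))
          (raPredictor ΔG (H t)) fstar (x t) = 1).card : ℝ) + (ΔG + 1) * Real.log (H T).card
        ≤ (ΔG + 1) * Real.log H0.card := by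
    induction T with
    | zero => simp [hinit, hf]
    | succ t ih =>
      obtain ⟨hmem, hle⟩ := ih
      rw [Finset.range_add_one, Finset.filter_insert, hstep t]
      split_ifs with hloss
      · have hmem' := mem_raUpdate_of_improvLoss G ΔG (H t) fstar hmem (x t) hloss
        refine ⟨hmem', ?_⟩
        have hlog := one_add_mul_log_le_mul_log hΔ
          (Nat.cast_pos.2 (Finset.card_pos.2 ⟨_, hmem'⟩))
          (Nat.cast_pos.2 (Finset.card_pos.2 ⟨_, hmem⟩))
          (card_raUpdate_le G ΔG hΔ (H t) (x t) (hdeg (x t)))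
        rw [Finset.card_insert_of_notMem (by simp)]
        push_cast
        linarith
      · exact ⟨hmem, hle⟩
  have hlog : 0 ≤ ((ΔG : ℝ) + 1) * Real.log (H T).card :=
    mul_nonneg (by positivity) (Real.log_natCast_nonneg _)
  linarith [hinv.2]
end

section
/- Let G = (V, E) be a finite undirected graph with maximum degree at most Δ_G, where Δ_G ≥ 1, and let the improvement function be Δ(x) = {x' ∈ V : (x, x') ∈ E}. Let H_0 be a finite nonempty set of functions V → Bool, let w : H_0 → ℝ with w_h > 0 for all h, and W = Σ_h w_h. Define the weighted risk-averse predictor ĥ(v) = true iff Σ_{h : h(v) = true} w_h ≥ (Δ_G/(Δ_G + 1))·W. Suppose querying node x ∈ V with ground-truth labeling g : V → Bool yields a mistake, i.e., Loss(x; ĥ, g) = 1, and define Δ⁺ = {x' ∈ Δ(x) : ĥ(x') = true} and H' = {h ∈ H_0 : h(x') = true for all x' ∈ Δ⁺}. Perform the update: if ĥ(x) = false and Δ⁺ = ∅, halve w_h for all h with h(x) = false; if ĥ(x) = false and Δ⁺ ≠ ∅, halve w_h for all h ∈ H'; if ĥ(x) = true, halve w_h for all h with h(x) = true. Then: (a)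 the new total weight satisfies W_new ≤ (1 − 1/(2(Δ_G + 1)))·W; and (b) every h ∈ H_0 whose weight was halved satisfies h(x) ≠ g(x) or has some neighbor x' ∈ Δ(x) with h(x') = true and g(x') = false. -/
/-- Halving the weights of a subset decreases the total weight by half the weight of the subset. -/
theorem sum_ite_mem_half {ι : Type*} (s t : Finset ι) (hts : t ⊆ s) (w : ι → ℝ)
    [DecidablePred (· ∈ t)] :
    ∑ i ∈ s, (if i ∈ t then w i / 2 else w i) = ∑ i ∈ s, w i - (∑ i ∈ t, w i) / 2 := by
  classical
  rw [← Finset.sum_sdiff hts, ← Finset.sum_sdiff hts (f := w), Finset.sum_div,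
    Finset.sum_congr rfl fun i hi => if_neg (Finset.mem_sdiff.1 hi).2,
    Finset.sum_congr (s₁ := t) rfl fun i hi => if_pos hi, ← Finset.sum_div]
  ring

/-- The weight of the hypotheses predicting positive and of those predicting negative add up to
the total weight. -/
theorem sum_filter_true_add_sum_filter_false {V : Type*} (H : Finset (V → Bool))
    (w : (V → Bool) → ℝ) (v : V) :
    ∑ h ∈ H with h v = true, w h + ∑ h ∈ H with h v = false, w h = ∑ h ∈ H, w h := by
  rw [← Finset.sum_filter_add_sum_filter_not H (fun h => h v = true)]
  simp

/-- Union bound: the total weight is at most the weight of the hypotheses positive on all of `S`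
plus the weights of those negative at each single point of `S`. -/
theorem sum_le_sum_filter_forall_add {V : Type*} (H : Finset (V → Bool))
    (w : (V → Bool) → ℝ) (hw : ∀ h ∈ H, 0 < w h) (S : Finset V) :
    ∑ h ∈ H, w h ≤ ∑ h ∈ H with (∀ v ∈ S, h v = true), w h
      + ∑ v ∈ S, ∑ h ∈ H with h v = false, w h := by
  simp only [Finset.sum_filter]
  rw [Finset.sum_comm, ← Finset.sum_add_distrib]
  refine Finset.sum_le_sum fun h hh => ?_
  have hnn : ∀ v ∈ S, 0 ≤ if h v = false then w h else 0 := fun v _ => by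
    split_ifs
    exacts [(hw h hh).le, le_rfl]
  by_cases hS : ∀ v ∈ S, h v = true
  · rw [if_pos hS]
    exact le_add_of_nonneg_right (Finset.sum_nonneg hnn)
  · rw [if_neg hS, zero_add]
    push Not at hS
    obtain ⟨v, hv, hvf⟩ := hS
    have hle := Finset.single_le_sum hnn hv
    rwa [if_pos (Bool.eq_false_of_not_eq_true hvf)] at hle

open Classical in
/-- Risk-averse weighted majority vote predictor: predict positive iff the hypotheses
predicting positive carry at least a `Δ_G/(Δ_G+1)` fraction of the total weight. -/
noncomputable def raWPredictor {V : Type*} (ΔG : ℕ) (H0 : Finset (V → Bool))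
    (w : (V → Bool) → ℝ) : V → Bool :=
  fun v => decide
    ((ΔG : ℝ) / (ΔG + 1) * (∑ h ∈ H0, w h) ≤ ∑ h ∈ H0.filter fun h => h v = true, w h)

open Classical in
/-- The set of hypotheses whose weight gets halved after a mistake on node `x` in the
risk-averse weighted majority vote algorithm. -/
noncomputable def raWHalved {V : Type*} [Fintype V] [DecidableEq V] (G : SimpleGraph V)
    [DecidableRel G.Adj] (ΔG : ℕ) (H0 : Finset (V → Bool)) (w : (V → Bool) → ℝ)
    (x : V) : Finset (V → Bool) :=
  let hhat := raWPredictor ΔG H0 w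
  let Δplus := (G.neighborFinset x).filter fun x' => hhat x' = true
  if hhat x = true then H0.filter fun h => h x = true
  else if Δplus = ∅ then H0.filter fun h => h x = false
  else H0.filter fun h => ∀ x' ∈ Δplus, h x' = true

open Classical in
/-- One step of the risk-averse weighted majority vote algorithm: after any mistake,
the total weight drops by a factor `1 - 1/(2(Δ_G+1))`, and every halved hypothesis
itself errs on the queried node (it mislabels it, or labels positive a neighbor whose
true label is negative). -/
theorem ra_weighted_step {V : Type*} [Fintype V] [DecidableEq V] (G : SimpleGraph V)
    [DecidableRel G.Adj] (ΔG : ℕ) (hΔ : 1 ≤ ΔG) (hdeg : ∀ v, G.degree v ≤ ΔG)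
    (H0 : Finset (V → Bool)) (hne : H0.Nonempty)
    (w : (V → Bool) → ℝ) (hw : ∀ h ∈ H0, 0 < w h)
    (g : V → Bool) (x : V)
    (hmistake : improvLoss (fun v => (G.neighborSet v : Set V))
      (raWPredictor ΔG H0 w) g x = 1) :
    (∑ h ∈ H0, (if h ∈ raWHalved G ΔG H0 w x then w h / 2 else w h))
        ≤ (1 - 1 / (2 * (ΔG + 1))) * ∑ h ∈ H0, w h ∧
      ∀ h ∈ raWHalved G ΔG H0 w x,
        h x ≠ g x ∨ ∃ x' ∈ G.neighborSet x, h x' = true ∧ g x' = false := by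
  have hW : 0 < ∑ h ∈ H0, w h := Finset.sum_pos hw hne
  set W := ∑ h ∈ H0, w h with hWdef
  have hfrac : (ΔG : ℝ) / (ΔG + 1) * W = W - W / (ΔG + 1) := by field_simp; ring
  have hpred : ∀ v, raWPredictor ΔG H0 w v = true ↔
      W - W / (ΔG + 1) ≤ ∑ h ∈ H0 with h v = true, w h := fun v => by
    simp only [raWPredictor, decide_eq_true_eq, ← hWdef, hfrac]
  have hsub : raWHalved G ΔG H0 w x ⊆ H0 := by
    simp only [raWHalved]
    split_ifs <;> exact Finset.filter_subset _ _
  have herr : ∃ x' ∈ reactionSet (fun v => G.neighborSet v) (raWPredictor ΔG H0 w) x,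
      raWPredictor ΔG H0 w x' ≠ g x' := by
    by_contra hcon
    simp [improvLoss, hcon] at hmistake
  suffices hmain : W / (ΔG + 1) ≤ ∑ h ∈ raWHalved G ΔG H0 w x, w h ∧
      ∀ h ∈ raWHalved G ΔG H0 w x,
        h x ≠ g x ∨ ∃ x' ∈ G.neighborSet x, h x' = true ∧ g x' = false by
    refine ⟨?_, hmain.2⟩
    rw [sum_ite_mem_half H0 _ hsub, ← hWdef]
    have : (1 - 1 / (2 * ((ΔG : ℝ) + 1))) * W = W - W / (ΔG + 1) / 2 := by
      field_simp
    linarith [hmain.1]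
  obtain ⟨y, hy, hyg⟩ := herr
  by_cases hx : raWPredictor ΔG H0 w x = true
  · have hyx : y = x := by simpa [reactionSet, hx] using hy
    subst hyx
    simp only [raWHalved, if_pos hx]
    constructor
    · have h1 := (hpred y).1 hx
      have h2 : W / (ΔG + 1) ≤ W / 2 := by
        have : (1 : ℝ) ≤ ΔG := by exact_mod_cast hΔ
        gcongr
        linarith
      linarith
    · intro h hh
      left
      rw [(Finset.mem_filter.1 hh).2, ← hx]
      exact hyg
  by_cases hP : (G.neighborFinset x).filter (fun x' => raWPredictor ΔG H0 w x' = true) = ∅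
  · have hno : ¬ ∃ x' ∈ G.neighborSet x, raWPredictor ΔG H0 w x' = true := by
      rintro ⟨z, hz, hzt⟩
      exact Finset.filter_eq_empty_iff.1 hP ((G.mem_neighborFinset x z).2 hz) hzt
    have hyx : y = x := by
      rw [reactionSet, if_pos (Or.inr hno)] at hy
      exact hy
    subst hyx
    simp only [raWHalved, if_neg hx, if_pos hP]
    constructor
    · have h1 := mt (hpred y).2 hx
      have h2 := sum_filter_true_add_sum_filter_false H0 w y
      linarith
    · intro h hh
      left
      rw [(Finset.mem_filter.1 hh).2, ← Bool.eq_false_of_not_eq_true hx]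
      exact hyg
  · have hyes : ∃ x' ∈ G.neighborSet x, raWPredictor ΔG H0 w x' = true := by
      obtain ⟨z, hz⟩ := Finset.nonempty_iff_ne_empty.2 hP
      rw [Finset.mem_filter, G.mem_neighborFinset] at hz
      exact ⟨z, hz⟩
    rw [reactionSet, if_neg (not_or.2 ⟨hx, not_not.2 hyes⟩)] at hy
    obtain ⟨hyN, hyt⟩ := hy
    simp only [raWHalved, if_neg hx, if_neg hP]
    constructor
    · set S := (G.neighborFinset x).filter (fun x' => raWPredictor ΔG H0 w x' = true)
      have h1 := sum_le_sum_filter_forall_add H0 w hw S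
      have h2 : ∑ v ∈ S, ∑ h ∈ H0 with h v = false, w h ≤ S.card • (W / (ΔG + 1)) := by
        refine Finset.sum_le_card_nsmul _ _ _ fun v hv => ?_
        have h3 := (hpred v).1 (Finset.mem_filter.1 hv).2
        have h4 := sum_filter_true_add_sum_filter_false H0 w v
        linarith
      have hcard : (S.card : ℝ) ≤ ΔG := by
        exact_mod_cast (Finset.card_filter_le _ _).trans (hdeg x)
      have h5 : (S.card : ℝ) * (W / (ΔG + 1)) ≤ ΔG * (W / (ΔG + 1)) := by gcongr
      have h6 : (ΔG : ℝ) * (W / (ΔG + 1)) = W - W / (ΔG + 1) := by rw [← hfrac]; ring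
      rw [nsmul_eq_mul] at h2
      refine le_trans ?_ ((sub_le_iff_le_add.2 h1).trans_eq (by congr!))
      linarith
    · intro h hh
      refine Or.inr ⟨y, hyN, (Finset.mem_filter.1 hh).2 y ?_, ?_⟩
      · exact Finset.mem_filter.2 ⟨(G.mem_neighborFinset x y).2 hyN, hyt⟩
      · rw [hyt] at hyg
        exact Bool.eq_false_of_not_eq_true fun hg => hyg hg.symm
end

section
/- Let G = (V, E) be a finite undirected graph with maximum degree at most Δ_G, where Δ_G ≥ 1, let the improvement function be Δ(x) = {x' ∈ V : (x, x') ∈ E}, and let H_0 be a finite nonempty set of functions V → Bool. Consider the online process over rounds t = 1,…,T: weights w^{(1)}_h = 1 for all h ∈ H_0; at round t, with W_t = Σ_h w^{(t)}_h, the predictor is ĥ_t(v) = true iff Σ_{h : h(v) = true} w^{(t)}_h ≥ (Δ_G/(Δ_G + 1))·W_t; the adversary chooses a node x_t and a ground-truth labeling g_t : V → Bool; a mistake occurs at round t iff Loss(x_t; ĥ_t, g_t) = 1; if a mistake occurs the weights are updated by the risk-averse weighted majority vote rule (with Δ⁺_t = {x' ∈ Δ(x_t) : ĥ_t(x') = true}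 and H'_t = {h ∈ H_0 : h(x') = true for all x' ∈ Δ⁺_t}: if ĥ_t(x_t) = false and Δ⁺_t = ∅, halve w_h for all h with h(x_t) = false; if ĥ_t(x_t) = false and Δ⁺_t ≠ ∅, halve w_h for all h ∈ H'_t; if ĥ_t(x_t) = true, halve w_h for all h with h(x_t) = true); otherwise weights are unchanged. Say a hypothesis h ∈ H_0 errs at round t if h(x_t) ≠ g_t(x_t) or some x' ∈ Δ(x_t) has h(x') = true and g_t(x') = false, and let OPT = min_{h ∈ H_0} |{t ≤ T : h errs at round t}|. Then the total number of mistakes M made by the learner satisfies M ≤ 2(Δ_G + 1)·(OPT·ln 2 + ln|H_0|). -/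
open Classical in
/-- The halved hypotheses always carry at least a `1/(Δ_G+1)` fraction of the total weight. -/
theorem sum_div_le_sum_raWHalved {V : Type*} [Fintype V] [DecidableEq V]
    (G : SimpleGraph V) [DecidableRel G.Adj] (ΔG : ℕ) (hΔ : 1 ≤ ΔG)
    (H0 : Finset (V → Bool)) (w : (V → Bool) → ℝ) (hw : ∀ h ∈ H0, 0 ≤ w h)
    (x : V) (hdeg : G.degree x ≤ ΔG) :
    (∑ h ∈ H0, w h) / (ΔG + 1) ≤ ∑ h ∈ raWHalved G ΔG H0 w x, w h := by
  have hD : (1 : ℝ) ≤ ΔG := by exact_mod_cast hΔ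
  have hW : 0 ≤ ∑ h ∈ H0, w h := Finset.sum_nonneg hw
  have hsplit : (ΔG : ℝ) / (ΔG + 1) * (∑ h ∈ H0, w h)
      = (∑ h ∈ H0, w h) - (∑ h ∈ H0, w h) / (ΔG + 1) := by
    field_simp
    ring
  have hcompl : ∀ v, (∑ h ∈ H0.filter (fun h => h v = true), w h)
      + (∑ h ∈ H0.filter (fun h => h v = false), w h) = ∑ h ∈ H0, w h := fun v => by
    simpa using Finset.sum_filter_add_sum_filter_not H0 (fun h => h v = true) w
  unfold raWHalved
  simp only
  split_ifs with h1 h2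
  · have h1' : (ΔG : ℝ) / (ΔG + 1) * (∑ h ∈ H0, w h)
        ≤ ∑ h ∈ H0.filter (fun h => h x = true), w h := by
      simpa [raWPredictor] using h1
    refine le_trans ?_ h1'
    rw [div_mul_eq_mul_div]
    gcongr
    nlinarith
  · have h1' : ∑ h ∈ H0.filter (fun h => h x = true), w h
        < (ΔG : ℝ) / (ΔG + 1) * (∑ h ∈ H0, w h) := by
      simpa [raWPredictor] using h1
    linarith [hcompl x]
  · set P := (G.neighborFinset x).filter fun x' => raWPredictor ΔG H0 w x' = true with hP
    have hfalse : ∀ v ∈ P, ∑ h ∈ H0.filter (fun h => h v = false), w h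
        ≤ (∑ h ∈ H0, w h) / (ΔG + 1) := fun v hv => by
      have h3 : (ΔG : ℝ) / (ΔG + 1) * (∑ h ∈ H0, w h)
          ≤ ∑ h ∈ H0.filter (fun h => h v = true), w h := by
        simpa [raWPredictor] using (Finset.mem_filter.1 hv).2
      linarith [hcompl v]
    have hcard : (P.card : ℝ) ≤ ΔG := by
      have : P.card ≤ ΔG := (Finset.card_filter_le _ _).trans
        ((G.card_neighborFinset_eq_degree x).le.trans hdeg)
      exact_mod_cast this
    have hunion : ∑ h ∈ H0.filter (fun h => ¬ ∀ x' ∈ P, h x' = true), w h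
        ≤ ∑ v ∈ P, ∑ h ∈ H0.filter (fun h => h v = false), w h := by
      have hnonneg : ∀ h ∈ H0, ∀ v, 0 ≤ if h v = false then w h else 0 := fun h hh v => by
        split_ifs
        exacts [hw h hh, le_rfl]
      simp_rw [Finset.sum_filter]
      rw [Finset.sum_comm]
      refine Finset.sum_le_sum fun h hh => ?_
      split_ifs with hc
      · exact Finset.sum_nonneg fun v _ => hnonneg h hh v
      · push Not at hc
        obtain ⟨v, hv, hvf⟩ := hc
        have := Finset.single_le_sum (f := fun v => if h v = false then w h else 0)
          (fun v _ => hnonneg h hh v) hv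
        simpa [hvf] using this
    have hbound : ∑ v ∈ P, ∑ h ∈ H0.filter (fun h => h v = false), w h
        ≤ (ΔG : ℝ) / (ΔG + 1) * (∑ h ∈ H0, w h) := by
      refine (Finset.sum_le_card_nsmul P _ _ hfalse).trans ?_
      rw [nsmul_eq_mul, div_mul_eq_mul_div, ← mul_div_assoc]
      gcongr
    have := Finset.sum_filter_add_sum_filter_not H0 (fun h => ∀ x' ∈ P, h x' = true) w
    linarith

open Classical in
/-- When the learner makes a mistake, every halved hypothesis errs. -/
theorem errs_of_mem_raWHalved {V : Type*} [Fintype V] [DecidableEq V]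
    (G : SimpleGraph V) [DecidableRel G.Adj] (ΔG : ℕ)
    (H0 : Finset (V → Bool)) (w : (V → Bool) → ℝ) (x : V) (g : V → Bool)
    (hloss : improvLoss (fun v => (G.neighborSet v : Set V)) (raWPredictor ΔG H0 w) g x = 1)
    (h : V → Bool) (hh : h ∈ raWHalved G ΔG H0 w x) :
    h x ≠ g x ∨ ∃ x' ∈ G.neighborSet x, h x' = true ∧ g x' = false := by
  have hex : ∃ x' ∈ reactionSet (fun v => (G.neighborSet v : Set V)) (raWPredictor ΔG H0 w) x,
      raWPredictor ΔG H0 w x' ≠ g x' := by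
    by_contra hc
    simp [improvLoss, hc] at hloss
  obtain ⟨y, hy, hne⟩ := hex
  unfold raWHalved at hh
  simp only at hh
  unfold reactionSet at hy
  generalize raWPredictor ΔG H0 w = p at *
  split_ifs at hh with h1 h2
  · rw [if_pos (Or.inl h1), Set.mem_singleton_iff] at hy
    subst hy
    left
    rw [(Finset.mem_filter.1 hh).2, ← h1]
    exact hne
  · have hnone : ¬ ∃ x' ∈ G.neighborSet x, p x' = true := by
      rintro ⟨v, hv, hpv⟩
      have : v ∈ (G.neighborFinset x).filter fun x' => p x' = true :=
        Finset.mem_filter.2 ⟨(G.mem_neighborFinset x v).2 hv, hpv⟩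
      simp [h2] at this
    rw [if_pos (Or.inr hnone), Set.mem_singleton_iff] at hy
    subst hy
    left
    rw [(Finset.mem_filter.1 hh).2, ← Bool.eq_false_iff.2 h1]
    exact hne
  · obtain ⟨v, hv⟩ := Finset.nonempty_iff_ne_empty.2 h2
    have hv' := Finset.mem_filter.1 hv
    have hsome : ∃ x' ∈ G.neighborSet x, p x' = true :=
      ⟨v, (G.mem_neighborFinset x v).1 hv'.1, hv'.2⟩
    rw [if_neg (not_or.2 ⟨h1, not_not.2 hsome⟩)] at hy
    refine Or.inr ⟨y, hy.1, (Finset.mem_filter.1 hh).2 y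
      (Finset.mem_filter.2 ⟨(G.mem_neighborFinset x y).2 hy.1, hy.2⟩), ?_⟩
    rw [hy.2] at hne
    exact Bool.eq_false_iff.2 hne.symm

/-- Potential argument for multiplicative halving: if in every round `t` with `mistake t` the
halved set `A t` carries at least a fraction `c` of the total weight, and some hypothesis `h₀` is
halved only in rounds with `err t`, then `c / 2 * #mistakes` is at most
`#err * log 2 + log #H`. -/
theorem card_mistakes_mul_le {α : Type*} (H : Finset α) (w : ℕ → α → ℝ)
    (A : ℕ → Finset α) (hA : ∀ t, A t ⊆ H) (mistake err : ℕ → Prop)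
    [DecidablePred mistake] [DecidablePred err] [DecidableEq α]
    (hinit : ∀ h ∈ H, w 0 h = 1)
    (hstep : ∀ t, ∀ h ∈ H, w (t + 1) h = if mistake t ∧ h ∈ A t then w t h / 2 else w t h)
    (c : ℝ)
    (hfrac : ∀ t, (∀ h ∈ H, 0 ≤ w t h) → c * ∑ h ∈ H, w t h ≤ ∑ h ∈ A t, w t h)
    (h₀ : α) (hh₀ : h₀ ∈ H) (herr : ∀ t, mistake t → h₀ ∈ A t → err t) (T : ℕ) :
    c / 2 * ((Finset.range T).filter mistake).card
      ≤ ((Finset.range T).filter err).card * Real.log 2 + Real.log H.card := by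
  have hpos : ∀ t, ∀ h ∈ H, 0 < w t h := by
    intro t
    induction t with
    | zero => intro h hh; rw [hinit h hh]; exact one_pos
    | succ t ih =>
      intro h hh
      have := ih h hh
      rw [hstep t h hh]
      split_ifs <;> linarith
  have hlower : ∀ t, (1 / 2 : ℝ) ^ ((Finset.range t).filter err).card ≤ w t h₀ := by
    intro t
    induction t with
    | zero => simp [hinit h₀ hh₀]
    | succ t ih =>
      have := hpos t h₀ hh₀
      rw [hstep t h₀ hh₀, Finset.range_add_one, Finset.filter_insert]
      by_cases he : err t
      · rw [if_pos he, Finset.card_insert_of_notMem (by simp), pow_succ]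
        split_ifs <;> linarith
      · rw [if_neg he, if_neg fun hm => he (herr t hm.1 hm.2)]
        exact ih
  have hupper : ∀ t, ∑ h ∈ H, w t h
      ≤ H.card * Real.exp (-(c / 2 * ((Finset.range t).filter mistake).card)) := by
    intro t
    induction t with
    | zero => simp [Finset.sum_congr rfl hinit]
    | succ t ih =>
      rw [Finset.sum_congr rfl (hstep t), Finset.range_add_one, Finset.filter_insert]
      by_cases hm : mistake t
      · have hsum : ∑ h ∈ H, (if h ∈ A t then w t h / 2 else w t h)
            = ∑ h ∈ H, w t h - (∑ h ∈ A t, w t h) / 2 := by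
          have hsub : ∑ h ∈ A t, w t h = ∑ h ∈ H, if h ∈ A t then w t h else 0 := by
            rw [← Finset.sum_filter, Finset.filter_mem_eq_inter, Finset.inter_eq_right.2 (hA t)]
          rw [hsub, Finset.sum_div, ← Finset.sum_sub_distrib]
          refine Finset.sum_congr rfl fun h _ => ?_
          split_ifs <;> ring
        have hf := hfrac t fun h hh => (hpos t h hh).le
        have hW : 0 ≤ ∑ h ∈ H, w t h := Finset.sum_nonneg fun h hh => (hpos t h hh).le
        simp only [hm, true_and, if_true]
        rw [hsum, Finset.card_insert_of_notMem (by simp)]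
        push_cast
        calc ∑ h ∈ H, w t h - (∑ h ∈ A t, w t h) / 2
            ≤ (∑ h ∈ H, w t h) * (-(c / 2) + 1) := by linarith
          _ ≤ (∑ h ∈ H, w t h) * Real.exp (-(c / 2)) := by
              gcongr
              exact Real.add_one_le_exp _
          _ ≤ H.card * Real.exp (-(c / 2 * ((Finset.range t).filter mistake).card))
                * Real.exp (-(c / 2)) := by gcongr
          _ = _ := by
              rw [mul_assoc, ← Real.exp_add]
              ring_nf
      · simpa [hm] using ih
  have hmain := (hlower T).trans ((Finset.single_le_sum
    (fun h hh => (hpos T h hh).le) hh₀).trans (hupper T))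
  have hcard : (H.card : ℝ) ≠ 0 := by
    exact_mod_cast Finset.card_ne_zero_of_mem hh₀
  have hlog := Real.log_le_log (by positivity) hmain
  rw [Real.log_mul hcard (Real.exp_ne_zero _), Real.log_exp, Real.log_pow, one_div,
    Real.log_inv] at hlog
  linarith

open Classical in
/-- Mistake bound for the risk-averse weighted majority vote algorithm in agnostic
online learning with improvements on a graph:
`M ≤ 2(Δ_G + 1)·(OPT·ln 2 + ln|H₀|)`. -/
theorem ra_weighted_mistake_bound {V : Type*} [Fintype V] [DecidableEq V]
    (G : SimpleGraph V) [DecidableRel G.Adj]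
    (ΔG : ℕ) (hΔ : 1 ≤ ΔG) (hdeg : ∀ v, G.degree v ≤ ΔG)
    (H0 : Finset (V → Bool)) (hne : H0.Nonempty)
    (x : ℕ → V) (g : ℕ → V → Bool)
    (w : ℕ → (V → Bool) → ℝ) (hinit : ∀ h ∈ H0, w 0 h = 1)
    (hstep : ∀ t, ∀ h ∈ H0, w (t + 1) h =
      if improvLoss (fun v => (G.neighborSet v : Set V))
            (raWPredictor ΔG H0 (w t)) (g t) (x t) = 1
          ∧ h ∈ raWHalved G ΔG H0 (w t) (x t)
      then w t h / 2 else w t h)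
    (T : ℕ) (OPT : ℕ)
    (hOPT : ∃ h ∈ H0, ((Finset.range T).filter fun t =>
        h (x t) ≠ g t (x t) ∨
          ∃ x' ∈ G.neighborSet (x t), h x' = true ∧ g t x' = false).card ≤ OPT) :
    (((Finset.range T).filter fun t =>
        improvLoss (fun v => (G.neighborSet v : Set V))
          (raWPredictor ΔG H0 (w t)) (g t) (x t) = 1).card : ℝ)
      ≤ 2 * (ΔG + 1) * (OPT * Real.log 2 + Real.log H0.card) := by
  obtain ⟨h₀, hh₀, hcount⟩ := hOPT
  have key := card_mistakes_mul_le H0 w (fun t => raWHalved G ΔG H0 (w t) (x t))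
    (fun t => by
      unfold raWHalved
      simp only
      split_ifs <;> exact Finset.filter_subset _ _)
    (fun t => improvLoss (fun v => (G.neighborSet v : Set V))
      (raWPredictor ΔG H0 (w t)) (g t) (x t) = 1)
    (fun t => h₀ (x t) ≠ g t (x t) ∨
      ∃ x' ∈ G.neighborSet (x t), h₀ x' = true ∧ g t x' = false)
    hinit (fun t h hh => by rw [hstep t h hh]) (1 / (ΔG + 1))
    (fun t hw => by
      rw [one_div_mul_eq_div]
      exact sum_div_le_sum_raWHalved G ΔG hΔ H0 (w t) hw (x t) (hdeg _))
    h₀ hh₀ (fun t hm hmem => errs_of_mem_raWHalved G ΔG H0 (w t) (x t) (g t) hm h₀ hmem) T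
  have hcount' : (((Finset.range T).filter fun t => h₀ (x t) ≠ g t (x t) ∨
      ∃ x' ∈ G.neighborSet (x t), h₀ x' = true ∧ g t x' = false).card : ℝ) ≤ OPT := by
    exact_mod_cast hcount
  have hlog2 : 0 ≤ Real.log 2 := Real.log_nonneg one_le_two
  have hkey := key.trans (add_le_add_left
    (mul_le_mul_of_nonneg_right hcount' hlog2) (Real.log H0.card))
  rw [div_div, one_div_mul_eq_div, div_le_iff₀ (by positivity)] at hkey
  linarith
end

section
/- Let the instance space be [0,1] ⊆ ℝ with D the uniform distribution on [0,1], and let the improvement function be Δ(x) = {x' ∈ [0,1] : |x' − x| ≤ 1/2}. For c ∈ (1/4, 3/4), define h_c : [0,1] → Bool by h_c(x) = true iff x ∈ [1/4, c) ∪ (c, 3/4]. Then for every b ∈ (1/4, 1/2] and every b' ∈ (1/4, 3/4) with b' ≠ b, the predictor h_{b'} against ground truth f* = h_b satisfies Loss(x; h_{b'}, h_b) = 1 for every x ∈ [0, 1/4), and consequently Loss_D(h_{b'}, h_b) ≥ 1/4. -/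
open MeasureTheory

theorem improvLoss_eq_one {X : Type*} {Δ : X → Set X} {h f : X → Bool} {x x' : X}
    (hx : h x = false) (hmem : x' ∈ Δ x) (hh : h x' = true) (hf : f x' = false) :
    improvLoss Δ h f x = 1 := by
  have hreact : x' ∈ reactionSet Δ h x := by
    rw [reactionSet, if_neg]
    · exact ⟨hmem, hh⟩
    · rintro (hx' | hno)
      · simp [hx] at hx'
      · exact hno ⟨x', hmem, hh⟩
  exact if_pos ⟨x', hreact, by simp [hh, hf]⟩

open Classical in
/-- The two-interval proper class on `[0,1]` with uniform data and improvement radius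
`1/2`: any hypothesis `h_{b'}` other than the target `h_b` errs (with improvements) on
every point of `[0, 1/4)`, hence has improvement loss at least `1/4`. -/
theorem proper_learning_fails_two_intervals (b b' : ℝ)
    (hb : b ∈ Set.Ioc (1 / 4 : ℝ) (1 / 2)) (hb' : b' ∈ Set.Ioo (1 / 4 : ℝ) (3 / 4))
    (hne : b' ≠ b) :
    (∀ x ∈ Set.Ico (0 : ℝ) (1 / 4),
      improvLoss (fun x => {x' : ℝ | x' ∈ Set.Icc (0 : ℝ) 1 ∧ |x' - x| ≤ 1 / 2})
        (fun x => decide (x ∈ Set.Ico (1 / 4 : ℝ) b' ∪ Set.Ioc b' (3 / 4)))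
        (fun x => decide (x ∈ Set.Ico (1 / 4 : ℝ) b ∪ Set.Ioc b (3 / 4))) x = 1) ∧
      ENNReal.ofReal (1 / 4) ≤
        (volume.restrict (Set.Icc (0 : ℝ) 1))
          {x : ℝ | improvLoss (fun x => {x' : ℝ | x' ∈ Set.Icc (0 : ℝ) 1 ∧ |x' - x| ≤ 1 / 2})
            (fun x => decide (x ∈ Set.Ico (1 / 4 : ℝ) b' ∪ Set.Ioc b' (3 / 4)))
            (fun x => decide (x ∈ Set.Ico (1 / 4 : ℝ) b ∪ Set.Ioc b (3 / 4))) x = 1} := by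
  obtain ⟨hb₁, hb₂⟩ := hb
  have hloss : ∀ x ∈ Set.Ico (0 : ℝ) (1 / 4),
      improvLoss (fun x => {x' : ℝ | x' ∈ Set.Icc (0 : ℝ) 1 ∧ |x' - x| ≤ 1 / 2})
        (fun x => decide (x ∈ Set.Ico (1 / 4 : ℝ) b' ∪ Set.Ioc b' (3 / 4)))
        (fun x => decide (x ∈ Set.Ico (1 / 4 : ℝ) b ∪ Set.Ioc b (3 / 4))) x = 1 := by
    rintro x ⟨hx₀, hx₁⟩
    apply improvLoss_eq_one (x' := b)
    on_goal 1 => apply decide_eq_false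
    on_goal 3 => apply decide_eq_true
    on_goal 4 => apply decide_eq_false
    · rintro (h | h)
      · linarith [h.1]
      · linarith [h.1, hb'.1]
    · exact ⟨⟨by linarith, by linarith⟩, abs_le.mpr ⟨by linarith, by linarith⟩⟩
    · rcases hne.lt_or_gt with h | h
      · exact Or.inr ⟨h, by linarith⟩
      · exact Or.inl ⟨hb₁.le, h⟩
    · rintro (h | h)
      · exact lt_irrefl _ h.2
      · exact lt_irrefl _ h.1
  refine ⟨hloss, ?_⟩
  calc ENNReal.ofReal (1 / 4)
      = (volume.restrict (Set.Icc (0 : ℝ) 1)) (Set.Ico 0 (1 / 4)) := by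
        have hsub : Set.Ico (0 : ℝ) (1 / 4) ⊆ Set.Icc 0 1 :=
          fun x hx => ⟨hx.1, by linarith [hx.2]⟩
        rw [Measure.restrict_eq_self _ hsub, Real.volume_Ico, sub_zero]
    _ ≤ _ := measure_mono hloss
end
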